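/- Let (W,S) be a Coxeter system, let X, X' ⊆ S, and let w ∈ W satisfy wXw^{-1} = X' (as subsets of W). Then w can be written w = v·u where u ∈ W_X satisfies uXu^{-1} = X, v satisfies vXv^{-1} = X', and l(vs) > l(v) for all s ∈ X. -/

import Mathlib

open scoped Pointwise

namespace CoxeterCommensurator

variable {B W : Type*} [Group W]

/-- The standard parabolic subgroup `W_X` of the Coxeter system `cs`, generated by the
simple reflections indexed by `X`. -/
def parab {M : CoxeterMatrix B} (cs : CoxeterSystem M W) (X : Set B) : Subgroup W :=
  Subgroup.closure (cs.simple '' X)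

section Exchange

variable {M : CoxeterMatrix B} (cs : CoxeterSystem M W)

open Classical in
/-- The action of the simple reflection `i` on `W × ZMod 2`: conjugate the first coordinate, and
flip the second one when the first one is the simple reflection itself. -/
noncomputable def signedConj (i : B) : Function.End (W × ZMod 2) :=
  fun p => (cs.simple i * p.1 * cs.simple i, p.2 + if p.1 = cs.simple i then 1 else 0)

open Classical in
theorem signedConj_mul_pow_apply (i j : B) (m : ℕ) (t : W) (e : ZMod 2) :
    ((signedConj cs i * signedConj cs j) ^ m) (t, e) =
      ((cs.simple i * cs.simple j) ^ m * t * ((cs.simple i * cs.simple j) ^ m)⁻¹,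
        e + ∑ n ∈ Finset.range (m + m),
          if cs.simple j * t = (cs.simple i * cs.simple j) ^ n then 1 else 0) := by
  induction m with
  | zero => simp; rfl
  | succ m ih =>
    rw [pow_succ']
    change signedConj cs i (signedConj cs j (((signedConj cs i * signedConj cs j) ^ m) (t, e))) = _
    rw [ih, show m + 1 + (m + 1) = m + m + 1 + 1 by ring, Finset.sum_range_succ,
      Finset.sum_range_succ]
    set r := cs.simple i * cs.simple j with hr
    have hinv : r⁻¹ = cs.simple j * cs.simple i := by simp [hr]
    have hc : SemiconjBy (cs.simple j) r r⁻¹ := by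
      rw [SemiconjBy, hinv, hr]; group
    have hcm : cs.simple j * r ^ m = (r ^ m)⁻¹ * cs.simple j := by
      have h := hc.pow_right m
      rwa [SemiconjBy, inv_pow] at h
    have hmul (g : W) : cs.simple j * t = g ↔ t = cs.simple j * g := by
      simpa using inv_mul_eq_iff_eq_mul (a := cs.simple j) (b := t) (c := g)
    have hfst : r ^ m * t * (r ^ m)⁻¹ = cs.simple j ↔ cs.simple j * t = r ^ (m + m) := by
      rw [hmul, mul_inv_eq_iff_eq_mul, ← eq_inv_mul_iff_mul_eq, ← mul_assoc, ← hcm, mul_assoc,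
        pow_add]
    have hsnd : cs.simple j * (r ^ m * t * (r ^ m)⁻¹) * cs.simple j = cs.simple i ↔
        cs.simple j * t = r ^ (m + m + 1) := by
      rw [hmul, ← eq_mul_inv_iff_mul_eq, ← eq_inv_mul_iff_mul_eq, cs.inv_simple, ← hr,
        mul_inv_eq_iff_eq_mul, ← eq_inv_mul_iff_mul_eq, ← mul_assoc, ← mul_assoc, ← hcm,
        mul_assoc, mul_assoc, ← pow_succ', ← pow_add, add_assoc]
    simp only [signedConj, hfst, hsnd]
    refine Prod.ext ?_ ?_
    · simp only [pow_succ', mul_inv_rev, cs.inv_simple, hr, mul_assoc]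
    · simp only [add_assoc]

theorem isLiftable_signedConj : M.IsLiftable (signedConj cs) := by
  classical
  intro i j
  funext ⟨t, e⟩
  rw [signedConj_mul_pow_apply, Finset.sum_range_add]
  simp [pow_add, CharTwo.add_self_eq_zero]
  rfl

open Classical in
theorem lift_signedConj_wordProd (ω : List B) (t : W) (e : ZMod 2) :
    cs.lift ⟨signedConj cs, isLiftable_signedConj cs⟩ (cs.wordProd ω) (t, e) =
      (cs.wordProd ω * t * (cs.wordProd ω)⁻¹, e + ((cs.rightInvSeq ω).count t : ZMod 2)) := by
  induction ω with
  | nil => simp; rfl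
  | cons i ω ih =>
    rw [cs.wordProd_cons, map_mul, cs.lift_apply_simple]
    change signedConj cs i (cs.lift ⟨signedConj cs, isLiftable_signedConj cs⟩
      (cs.wordProd ω) (t, e)) = _
    have h : cs.wordProd ω * t * (cs.wordProd ω)⁻¹ = cs.simple i ↔
        (cs.wordProd ω)⁻¹ * cs.simple i * cs.wordProd ω = t := by
      rw [mul_inv_eq_iff_eq_mul, mul_assoc, inv_mul_eq_iff_eq_mul, eq_comm]
    rw [ih]
    simp only [signedConj, h, CoxeterSystem.rightInvSeq, List.count_cons, beq_iff_eq]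
    refine Prod.ext ?_ ?_
    · simp [mul_assoc]
    · push_cast
      simp [add_assoc]

open Classical in
theorem count_rightInvSeq_eq {ω τ : List B} (h : cs.wordProd ω = cs.wordProd τ) (t : W) :
    ((cs.rightInvSeq ω).count t : ZMod 2) = (cs.rightInvSeq τ).count t := by
  have hω := lift_signedConj_wordProd cs ω t 0
  rw [h, lift_signedConj_wordProd] at hω
  simpa using (congrArg Prod.snd hω).symm

/-- **Exchange condition**, membership form. -/
theorem simple_mem_rightInvSeq {ω : List B} {i : B} (h : cs.IsRightDescent (cs.wordProd ω) i) :
    cs.simple i ∈ cs.rightInvSeq ω := by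
  classical
  obtain ⟨τ, hτ, hτw⟩ := cs.exists_isReduced (cs.wordProd ω * cs.simple i)
  have hprod : cs.wordProd (τ.concat i) = cs.wordProd ω := by
    rw [cs.wordProd_concat, ← hτw, cs.simple_mul_simple_cancel_right]
  have hred : cs.IsReduced (τ.concat i) := by
    rw [CoxeterSystem.IsReduced, hprod, List.length_concat, ← hτ.eq, ← hτw]
    exact (cs.isRightDescent_iff.mp h).symm
  have hmem : cs.simple i ∈ cs.rightInvSeq (τ.concat i) := by
    rw [cs.rightInvSeq_concat]; simp
  have hcount := count_rightInvSeq_eq cs hprod (cs.simple i)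
  rw [List.count_eq_one_of_mem hred.nodup_rightInvSeq hmem] at hcount
  by_contra hn
  rw [List.count_eq_zero_of_not_mem hn] at hcount
  simp at hcount

/-- **Exchange condition**. -/
theorem exists_wordProd_mul_simple_eq_eraseIdx {ω : List B} {i : B}
    (h : cs.IsRightDescent (cs.wordProd ω) i) :
    ∃ j < ω.length, cs.wordProd ω * cs.simple i = cs.wordProd (ω.eraseIdx j) := by
  obtain ⟨j, hj, hji⟩ := List.getElem_of_mem (simple_mem_rightInvSeq cs h)
  refine ⟨j, by simpa using hj, ?_⟩
  rw [← cs.wordProd_mul_getD_rightInvSeq, List.getD_eq_getElem _ _ hj, hji]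

end Exchange

section Parabolic

variable {M : CoxeterMatrix B} (cs : CoxeterSystem M W) {X : Set B}

theorem simple_mem_parab {b : B} (hb : b ∈ X) : cs.simple b ∈ parab cs X :=
  Subgroup.subset_closure ⟨b, hb, rfl⟩

theorem wordProd_mem_parab {ω : List B} (h : ∀ b ∈ ω, b ∈ X) : cs.wordProd ω ∈ parab cs X := by
  refine Subgroup.list_prod_mem _ fun x hx => ?_
  obtain ⟨b, hb, rfl⟩ := List.mem_map.mp hx
  exact simple_mem_parab cs (h b hb)

theorem exists_isReduced_of_mem_parab {x : W} (hx : x ∈ parab cs X) :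
    ∃ ω : List B, cs.IsReduced ω ∧ (∀ b ∈ ω, b ∈ X) ∧ x = cs.wordProd ω := by
  have step : ∀ x : W, ∀ b ∈ X,
      (∃ ω : List B, cs.IsReduced ω ∧ (∀ b ∈ ω, b ∈ X) ∧ x = cs.wordProd ω) →
      ∃ ω : List B, cs.IsReduced ω ∧ (∀ b ∈ ω, b ∈ X) ∧ x * cs.simple b = cs.wordProd ω := by
    rintro _ b hb ⟨ω, hω, hωX, rfl⟩
    by_cases hd : cs.IsRightDescent (cs.wordProd ω) b
    · obtain ⟨j, hj, hjω⟩ := exists_wordProd_mul_simple_eq_eraseIdx cs hd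
      refine ⟨ω.eraseIdx j, ?_, fun c hc => hωX c (List.mem_of_mem_eraseIdx hc), hjω⟩
      have h₁ := cs.isRightDescent_iff.mp hd
      have h₂ := hω.eq
      rw [CoxeterSystem.IsReduced, ← hjω, List.length_eraseIdx_of_lt hj]
      omega
    · refine ⟨ω.concat b, ?_, ?_, (cs.wordProd_concat b ω).symm⟩
      · rw [CoxeterSystem.IsReduced, cs.wordProd_concat, cs.not_isRightDescent_iff.mp hd,
          List.length_concat, hω.eq]
      · intro c hc
        rw [List.concat_eq_append, List.mem_append, List.mem_singleton] at hc
        rcases hc with hc | rfl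
        exacts [hωX c hc, hb]
  induction hx using Subgroup.closure_induction_right with
  | one => exact ⟨[], by simp [CoxeterSystem.IsReduced], by simp, by simp⟩
  | mul_right x hx y hy ih =>
    obtain ⟨b, hb, rfl⟩ := hy
    exact step x b hb ih
  | mul_inv_cancel x hx y hy ih =>
    obtain ⟨b, hb, rfl⟩ := hy
    rw [cs.inv_simple]
    exact step x b hb ih

theorem mem_simple_image_of_length_eq_one {x : W} (hx : x ∈ parab cs X) (h : cs.length x = 1) :
    x ∈ cs.simple '' X := by
  obtain ⟨ω, hω, hωX, rfl⟩ := exists_isReduced_of_mem_parab cs hx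
  rw [hω.eq] at h
  obtain ⟨b, rfl⟩ := List.length_eq_one_iff.mp h
  exact ⟨b, hωX b (by simp), by simp⟩

/-- Lengths add along the factorization of a coset of `W_X` through its minimal element. -/
theorem length_mul_of_forall_length_le {v : W}
    (hv : ∀ x ∈ parab cs X, cs.length v ≤ cs.length (v * x)) {x : W} (hx : x ∈ parab cs X) :
    cs.length (v * x) = cs.length v + cs.length x := by
  obtain ⟨ω, hω, hωX, rfl⟩ := exists_isReduced_of_mem_parab cs hx
  clear hx
  induction ω using List.reverseRecOn with
  | nil => simp
  | append_singleton ω i ih =>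
    have hωr : cs.IsReduced ω := by simpa using hω.take ω.length
    have hωX' : ∀ b ∈ ω, b ∈ X := fun b hb => hωX b (by simp [hb])
    have hi : i ∈ X := hωX i (by simp)
    have ih := ih hωr hωX'
    have hlen := hω.eq
    rw [List.length_append, List.length_singleton] at hlen
    rw [hlen]
    rw [cs.wordProd_append, cs.wordProd_singleton] at hlen ⊢
    have hωlen := hωr.eq
    suffices hd : ¬ cs.IsRightDescent (v * cs.wordProd ω) i by
      rw [← mul_assoc, cs.not_isRightDescent_iff.mp hd, ih, hωlen, add_assoc]
    intro hd
    obtain ⟨τ, hτ, rfl⟩ := cs.exists_isReduced v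
    rw [← cs.wordProd_append] at hd
    obtain ⟨j, hj, hjeq⟩ := exists_wordProd_mul_simple_eq_eraseIdx cs hd
    rw [cs.wordProd_append] at hjeq
    by_cases hjτ : j < τ.length
    · rw [List.eraseIdx_append_of_lt_length hjτ, cs.wordProd_append] at hjeq
      have hshort : cs.wordProd τ * (cs.wordProd ω * cs.simple i * (cs.wordProd ω)⁻¹) =
          cs.wordProd (τ.eraseIdx j) := by
        rw [← mul_assoc, ← mul_assoc, hjeq, mul_inv_cancel_right]
      have hmem : cs.wordProd ω * cs.simple i * (cs.wordProd ω)⁻¹ ∈ parab cs X :=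
        mul_mem (mul_mem (wordProd_mem_parab cs hωX') (simple_mem_parab cs hi))
          (inv_mem (wordProd_mem_parab cs hωX'))
      have h₁ := hv _ hmem
      rw [hshort, hτ.eq] at h₁
      have h₂ := cs.length_wordProd_le (τ.eraseIdx j)
      rw [List.length_eraseIdx_of_lt hjτ] at h₂
      omega
    · rw [List.eraseIdx_append_of_length_le (not_lt.mp hjτ), cs.wordProd_append, mul_assoc,
        mul_left_cancel_iff] at hjeq
      have h₁ := cs.length_wordProd_le (ω.eraseIdx (j - τ.length))
      have h₂ := List.length_eraseIdx_le ω (j - τ.length)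
      rw [← hjeq] at h₁
      omega

end Parabolic

/-- **Lemma 3.9.** If `w X w⁻¹ = X'`, then `w = v · u` where `u ∈ W_X` satisfies
`u X u⁻¹ = X`, `v` satisfies `v X v⁻¹ = X'`, and `l(v s) > l(v)` for all `s ∈ X`. -/
theorem conj_simple_set_decomposition {B W : Type*} [Group W]
    (M : CoxeterMatrix B) (cs : CoxeterSystem M W) (X X' : Set B) (w : W)
    (hw : (fun t => w * t * w⁻¹) '' (cs.simple '' X) = cs.simple '' X') :
    ∃ v u : W, w = v * u ∧ u ∈ parab cs X ∧
      (fun t => u * t * u⁻¹) '' (cs.simple '' X) = cs.simple '' X ∧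
      (fun t => v * t * v⁻¹) '' (cs.simple '' X) = cs.simple '' X' ∧
      ∀ b ∈ X, cs.length v < cs.length (v * cs.simple b) := by
  obtain ⟨y, hy, hmin⟩ := exists_minimalFor_of_wellFoundedLT
    (fun x : W => x ∈ parab cs X) (fun x => cs.length (w * x)) ⟨1, one_mem _⟩
  have hv : ∀ x ∈ parab cs X, cs.length (w * y) ≤ cs.length (w * y * x) := by
    intro x hx
    rw [mul_assoc]
    exact (le_total _ _).elim id fun h => hmin (mul_mem hy hx) h
  have hsub : (fun t => y⁻¹ * t * y⁻¹⁻¹) '' (cs.simple '' X) ⊆ cs.simple '' X := by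
    rintro _ ⟨_, ⟨b, hb, rfl⟩, rfl⟩
    have hmem : y⁻¹ * cs.simple b * y⁻¹⁻¹ ∈ parab cs X :=
      mul_mem (mul_mem (inv_mem hy) (simple_mem_parab cs hb)) (inv_mem (inv_mem hy))
    refine mem_simple_image_of_length_eq_one cs hmem ?_
    obtain ⟨c, -, hc⟩ : w * cs.simple b * w⁻¹ ∈ cs.simple '' X' := hw ▸ ⟨_, ⟨b, hb, rfl⟩, rfl⟩
    have hadd := length_mul_of_forall_length_le cs hv hmem
    have heq : w * y * (y⁻¹ * cs.simple b * y⁻¹⁻¹) = cs.simple c * (w * y) := by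
      rw [hc]; group
    have hle := cs.length_mul_le (cs.simple c) (w * y)
    rw [cs.length_simple, ← heq, hadd] at hle
    have hpos := ((cs.isReflection_simple b).conj y⁻¹).odd_length.pos
    beta_reduce
    omega
  have hu : (fun t => y⁻¹ * t * y⁻¹⁻¹) '' (cs.simple '' X) = cs.simple '' X := by
    refine hsub.antisymm ?_
    obtain ⟨Y, hYX, hY⟩ := Set.subset_image_iff.mp hsub
    have hconj : ∀ x ∈ parab cs X, y⁻¹ * x * y⁻¹⁻¹ ∈ parab cs Y := by
      have hle : parab cs X ≤ (parab cs Y).comap (MulAut.conj y⁻¹).toMonoidHom := by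
        refine (Subgroup.closure_le _).mpr fun t ht => ?_
        refine Subgroup.subset_closure ?_
        rw [hY]
        exact ⟨t, ht, rfl⟩
      exact fun x hx => hle hx
    rintro _ ⟨b, hb, rfl⟩
    have h := hconj _ (mul_mem (mul_mem hy (simple_mem_parab cs hb)) (inv_mem hy))
    rw [show y⁻¹ * (y * cs.simple b * y⁻¹) * y⁻¹⁻¹ = cs.simple b by group] at h
    rw [← hY]
    exact mem_simple_image_of_length_eq_one cs h (cs.length_simple b)
  refine ⟨w * y, y⁻¹, by group, inv_mem hy, hu, ?_, fun b hb => ?_⟩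
  · rw [← hw]
    conv_lhs => rw [← hu]
    rw [Set.image_image]
    refine Set.image_congr fun t _ => ?_
    group
  · exact lt_of_le_of_ne (hv _ (simple_mem_parab cs hb)) (cs.length_mul_simple_ne _ b).symm

end CoxeterCommensurator
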